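/- arXiv:2302.12546 — 3 statements merged into one kernel-verified Lean document; each statement's English description precedes it below -/
import Mathlib

section
/- Kirchhoff's theorem (eigenvalue form): Let G be a connected finite simple graph on N ≥ 2 vertices and let L(G) be its Laplacian matrix. Since G is connected, 0 is a simple eigenvalue of L(G); let λ_1, …, λ_{N−1} denote the remaining (nonzero) eigenvalues of L(G), listed with multiplicity. Then the number of spanning trees of G satisfies t(G) = (1/N) · λ_1 · λ_2 ⋯ λ_{N−1}. -/
/-- The number of spanning trees of a simple graph `G`: the number of subgraphs
(on the full vertex set) that are contained in `G` and are trees. -/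
noncomputable def spanningTreeCount {V : Type*} (G : SimpleGraph V) : ℕ :=
  Nat.card {H : SimpleGraph V // H ≤ G ∧ H.IsTree}

namespace KirchhoffAux

open Finset Matrix

/-- The self-map of `V` extending a parent function `f : s → V` by the identity. -/
def ext {V : Type*} [DecidableEq V] {s : Finset V} (f : s → V) (v : V) : V :=
  if h : v ∈ s then f ⟨v, h⟩ else v

/-- The matrix of a parent function, restricted to `s`. -/
def pmat {V : Type*} [DecidableEq V] {s : Finset V} (f : s → V) : Matrix s s ℝ :=
  fun i j => if f i = j then 1 else 0

/-- Every vertex is led to `r` by iterating the parent function. -/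
def Reach {V : Type*} [DecidableEq V] {s : Finset V} (r : V) (f : s → V) : Prop :=
  ∀ v : V, ∃ k : ℕ, (ext f)^[k] v = r

/-- The graph of a parent function. -/
def pgraph {V : Type*} {s : Finset V} (f : s → V) : SimpleGraph V :=
  SimpleGraph.fromEdgeSet (Set.range fun i : s => s((i : V), f i))

section
variable {V : Type*} [Fintype V] [DecidableEq V] {s : Finset V} {r : V}

lemma ext_mem (f : s → V) (i : s) : ext f i = f i := by simp [ext]

lemma ext_root (hs : ∀ v, v ∈ s ↔ v ≠ r) (f : s → V) : ext f r = r := by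
  simp [ext, hs]

lemma iter_root (hs : ∀ v, v ∈ s ↔ v ≠ r) (f : s → V) (k : ℕ) : (ext f)^[k] r = r :=
  Function.iterate_fixed (ext_root hs f) k

lemma pmat_pow (hs : ∀ v, v ∈ s ↔ v ≠ r) (f : s → V) (k : ℕ) (i j : s) :
    (pmat f ^ k) i j = if (ext f)^[k] i = j then 1 else 0 := by
  induction k generalizing i with
  | zero =>
    rw [pow_zero, Matrix.one_apply, Function.iterate_zero_apply]
    by_cases h : i = j
    · rw [if_pos h, if_pos (congrArg Subtype.val h)]
    · rw [if_neg h, if_neg (fun h' => h (Subtype.ext h'))]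
  | succ k ih =>
    rw [pow_succ', Matrix.mul_apply, Function.iterate_succ_apply, ext_mem]
    simp_rw [ih]
    by_cases h : f i ∈ s
    · rw [Finset.sum_eq_single (⟨f i, h⟩ : s)]
      · simp [pmat]
      · intro b _ hb
        have : f i ≠ b := fun h' => hb (Subtype.ext h'.symm)
        simp [pmat, this]
      · simp
    · have hr : f i = r := by by_contra h'; exact h ((hs _).2 h')
      rw [hr, iter_root hs, if_neg]
      · apply Finset.sum_eq_zero
        intro b _
        have : f i ≠ b := fun h' => h (h' ▸ b.2)
        simp [pmat, this]
      · exact fun h' => (hs _).1 j.2 h'.symm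

lemma det_reach (hs : ∀ v, v ∈ s ↔ v ≠ r) (f : s → V) (hf : Reach r f) :
    (1 - pmat f).det = 1 := by
  choose k hk using hf
  have hnil : IsNilpotent (pmat f) := by
    refine ⟨∑ v, k v, ?_⟩
    ext i j
    rw [pmat_pow hs, if_neg]; rfl
    have hle : k i ≤ ∑ v, k v := Finset.single_le_sum (fun _ _ => Nat.zero_le _) (mem_univ _)
    obtain ⟨m, hm⟩ := Nat.exists_eq_add_of_le hle
    rw [hm, add_comm, Function.iterate_add_apply, hk, iter_root hs]
    exact fun h' => (hs _).1 j.2 h'.symm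
  have h := (Matrix.isNilpotent_charpoly_sub_pow_of_isNilpotent hnil).eq_zero
  have h2 := congrArg (Polynomial.eval 1) h
  rw [Polynomial.eval_sub, Matrix.eval_charpoly] at h2
  simp at h2
  linarith

lemma det_not_reach (hs : ∀ v, v ∈ s ↔ v ≠ r) (f : s → V) (hf : ¬ Reach r f) :
    (1 - pmat f).det = 0 := by
  classical
  simp only [Reach, not_forall] at hf
  obtain ⟨v, hv⟩ := hf
  have hvs : v ∈ s := (hs v).2 fun h => hv ⟨0, h⟩
  rw [← Matrix.exists_mulVec_eq_zero_iff]
  have key : ∀ i : s, (∃ k, (ext f)^[k] i = r) ↔ ∃ k, (ext f)^[k] (f i) = r := by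
    intro i
    rw [← ext_mem f i]
    constructor
    · rintro ⟨k, hk⟩
      refine ⟨k, ?_⟩
      rw [← Function.iterate_succ_apply, Function.iterate_succ_apply', hk, ext_root hs]
    · rintro ⟨k, hk⟩
      exact ⟨k + 1, hk⟩
  refine ⟨fun i => if ∃ k, (ext f)^[k] i = r then 0 else 1, ?_, ?_⟩
  · intro h
    have := congrFun h ⟨v, hvs⟩
    simp only [if_neg hv] at this
    simp at this
  · rw [Matrix.sub_mulVec, Matrix.one_mulVec, sub_eq_zero]
    funext i
    simp only [Matrix.mulVec, dotProduct, pmat]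
    by_cases h : f i ∈ s
    · rw [Finset.sum_eq_single (⟨f i, h⟩ : s)]
      · simp [key i]
      · intro b _ hb
        have : f i ≠ b := fun h' => hb (Subtype.ext h'.symm)
        simp [this]
      · simp
    · have hr : f i = r := by by_contra h'; exact h ((hs _).2 h')
      rw [if_pos ((key i).2 ⟨0, hr⟩)]
      symm
      apply Finset.sum_eq_zero
      intro b _
      have : f i ≠ b := fun h' => h (h' ▸ b.2)
      simp [this]

lemma reach_induct {f : s → V} (hf : Reach r f) (P : V → Prop) (h0 : P r)
    (h : ∀ i : s, P (f i) → P i) (v : V) : P v := by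
  obtain ⟨k, hk⟩ := hf v
  induction k generalizing v with
  | zero =>
    rw [Function.iterate_zero_apply] at hk
    exact hk.symm ▸ h0
  | succ k ih =>
    rw [Function.iterate_succ_apply] at hk
    have := ih _ hk
    by_cases hv : v ∈ s
    · rw [ext_mem f ⟨v, hv⟩] at this
      exact h ⟨v, hv⟩ this
    · simpa [ext, hv] using this

lemma pgraph_adj (f : s → V) (hne : ∀ i, f i ≠ i) (i : s) : (pgraph f).Adj i (f i) := by
  rw [pgraph, SimpleGraph.fromEdgeSet_adj]
  exact ⟨⟨i, rfl⟩, (hne i).symm⟩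

lemma adj_pgraph {f : s → V} {a b : V} (h : (pgraph f).Adj a b) :
    (∃ i : s, (i : V) = a ∧ f i = b) ∨ (∃ i : s, (i : V) = b ∧ f i = a) := by
  rw [pgraph, SimpleGraph.fromEdgeSet_adj] at h
  obtain ⟨⟨i, hi⟩, -⟩ := h
  simp only [Sym2.eq_iff] at hi
  rcases hi with h | h
  · exact Or.inl ⟨i, h⟩
  · exact Or.inr ⟨i, h⟩

lemma pgraph_connected {f : s → V} (hne : ∀ i, f i ≠ i) (hf : Reach r f) :
    (pgraph f).Connected := by
  have h : ∀ v, (pgraph f).Reachable v r :=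
    reach_induct hf _ (SimpleGraph.Reachable.refl _)
      fun i hi => (pgraph_adj f hne i).reachable.trans hi
  have : Nonempty V := ⟨r⟩
  exact ⟨fun u v => (h u).trans (h v).symm⟩

lemma pgraph_isTree (hs : ∀ v, v ∈ s ↔ v ≠ r) {f : s → V} (hne : ∀ i, f i ≠ i)
    (hf : Reach r f) : (pgraph f).IsTree := by
  have hc := pgraph_connected hne hf
  rw [SimpleGraph.isTree_iff_connected_and_card]
  refine ⟨hc, le_antisymm ?_ hc.card_vert_le_card_edgeSet_add_one⟩
  have hse : s = univ.erase r := by ext v; simp [hs]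
  have hcard : s.card + 1 = Nat.card V := by
    rw [hse, Nat.card_eq_fintype_card, Finset.card_erase_add_one (mem_univ _), card_univ]
  rw [← hcard]
  have : Nat.card (pgraph f).edgeSet ≤ Nat.card s := by
    refine (Nat.card_mono (Set.toFinite _) ?_).trans
      (Finite.card_range_le (fun i : s => s((i : V), f i)))
    rw [pgraph, SimpleGraph.edgeSet_fromEdgeSet]
    exact Set.sdiff_subset
  simpa using this

lemma pgraph_injective (hs : ∀ v, v ∈ s ↔ v ≠ r) {f g : s → V} (hnf : ∀ i, f i ≠ i)
    (hf : Reach r f) (hfg : pgraph f = pgraph g) : f = g := by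
  -- no vertex at which `f` and `g` differ can ever reach the root
  have key : ∀ v : V, ∀ i : s, (i : V) = v → f i = g i := by
    refine reach_induct hf (fun v => ∀ i : s, (i : V) = v → f i = g i) ?_ ?_
    · intro i hi
      exact absurd hi ((hs _).1 i.2)
    · intro i ih i' hi'
      obtain rfl : i' = i := Subtype.ext hi'
      by_contra hne
      have h1 := pgraph_adj f hnf i'
      rw [hfg] at h1
      rcases adj_pgraph h1 with ⟨j, hj, hj2⟩ | ⟨j, hj, hj2⟩
      · obtain rfl : j = i' := Subtype.ext hj
        exact hne hj2.symm
      · have h2 : f j = i' := (ih j hj).trans hj2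
        -- now `f` has a 2-cycle
        have : ∀ v : V, v ≠ i' ∧ v ≠ j := by
          refine reach_induct hf (fun v => v ≠ i' ∧ v ≠ j) ⟨?_, ?_⟩ ?_
          · exact fun h => (hs _).1 i'.2 h.symm
          · exact fun h => (hs _).1 j.2 h.symm
          · rintro m ⟨hm1, hm2⟩
            constructor
            · intro h
              obtain rfl : m = i' := Subtype.ext h
              exact hm2 hj.symm
            · intro h
              obtain rfl : m = j := Subtype.ext h
              exact hm1 h2
        exact (this i').1 rfl
  funext i
  exact key i i rfl

lemma exists_parent (hs : ∀ v, v ∈ s ↔ v ≠ r) {H : SimpleGraph V} (hH : H.IsTree) :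
    ∃ f : s → V, (∀ i : s, H.Adj i (f i)) ∧ Reach r f ∧ pgraph f = H := by
  have h1 : ∀ i : s, ∃ w, H.Adj i w ∧ H.dist w r < H.dist i r := by
    intro i
    obtain ⟨p, hp⟩ := hH.connected.exists_walk_length_eq_dist i r
    cases p with
    | nil => exact absurd rfl ((hs _).1 i.2)
    | cons h q =>
      refine ⟨_, h, ?_⟩
      have := SimpleGraph.dist_le q
      rw [SimpleGraph.Walk.length_cons] at hp
      omega
  choose f hf hd using h1
  have hreach : Reach r f := by
    have : ∀ n : ℕ, ∀ v, H.dist v r = n → ∃ k, (ext f)^[k] v = r := by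
      intro n
      induction n using Nat.strong_induction_on with
      | _ n ih =>
        intro v hv
        by_cases hvs : v ∈ s
        · obtain ⟨k, hk⟩ := ih _ (hv ▸ hd ⟨v, hvs⟩) _ rfl
          refine ⟨k + 1, ?_⟩
          rw [Function.iterate_succ_apply, ext_mem f ⟨v, hvs⟩, hk]
        · refine ⟨0, ?_⟩
          by_contra h'
          exact hvs ((hs _).2 h')
    exact fun v => this _ v rfl
  have hle : pgraph f ≤ H := by
    intro a b hab
    rcases adj_pgraph hab with ⟨i, rfl, rfl⟩ | ⟨i, rfl, rfl⟩
    · exact hf i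
    · exact (hf i).symm
  refine ⟨f, hf, hreach, le_antisymm hle ?_⟩
  exact (SimpleGraph.isTree_iff_minimal_connected.1 hH).2
    (pgraph_connected (fun i => (hf i).ne') hreach) hle

lemma minor_eq (G : SimpleGraph V) [DecidableRel G.Adj] (hs : ∀ v, v ∈ s ↔ v ≠ r) :
    ((G.lapMatrix ℝ).submatrix (Subtype.val : s → V) (Subtype.val : s → V)).det
      = (spanningTreeCount G : ℝ) := by
  classical
  have hrow : ((G.lapMatrix ℝ).submatrix (Subtype.val : s → V) (Subtype.val : s → V))
      = fun i : s => ∑ w ∈ G.neighborFinset i,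
          (fun l : s => (if i = l then (1 : ℝ) else 0) - if w = l then 1 else 0) := by
    funext i l
    rw [Finset.sum_apply, Finset.sum_sub_distrib, Finset.sum_ite_eq']
    by_cases h : i = l
    · subst h
      simp [SimpleGraph.lapMatrix, SimpleGraph.degMatrix, SimpleGraph.adjMatrix_apply]
    · have h' : (i : V) ≠ l := fun h' => h (Subtype.ext h')
      simp [SimpleGraph.lapMatrix, SimpleGraph.degMatrix, SimpleGraph.adjMatrix_apply, h, h']
  have hdet : ((G.lapMatrix ℝ).submatrix (Subtype.val : s → V) (Subtype.val : s → V)).det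
      = ∑ f ∈ Fintype.piFinset (fun i : s => G.neighborFinset i), (1 - pmat f).det := by
    rw [hrow]
    refine (MultilinearMap.map_sum_finset
      (Matrix.detRowAlternating (n := s) (R := ℝ)).toMultilinearMap _ _).trans ?_
    refine Finset.sum_congr rfl fun f _ => ?_
    change Matrix.det _ = _
    congr 1
  have hval : ∀ f : s → V, (1 - pmat f).det = if Reach r f then (1 : ℝ) else 0 := by
    intro f
    split_ifs with h
    · exact det_reach hs f h
    · exact det_not_reach hs f h
  rw [hdet]
  simp_rw [hval]
  rw [Finset.sum_boole, spanningTreeCount, ← Nat.card_eq_finsetCard]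
  congr 1
  have hmem : ∀ f : s → V, f ∈ {f ∈ Fintype.piFinset (fun i : s => G.neighborFinset i) |
      Reach r f} ↔ (∀ i : s, G.Adj i (f i)) ∧ Reach r f := by
    intro f
    simp [Fintype.mem_piFinset]
  refine Nat.card_eq_of_bijective (fun f => ⟨pgraph f.1, ?_, ?_⟩) ⟨?_, ?_⟩
  · intro a b hab
    have hf := ((hmem _).1 f.2).1
    rcases adj_pgraph hab with ⟨i, rfl, rfl⟩ | ⟨i, rfl, rfl⟩
    · exact hf i
    · exact (hf i).symm
  · have hf := (hmem _).1 f.2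
    exact pgraph_isTree hs (fun i => (hf.1 i).ne') hf.2
  · intro f g hfg
    have hf := (hmem _).1 f.2
    exact Subtype.ext (pgraph_injective hs (fun i => (hf.1 i).ne') hf.2
      (congrArg Subtype.val hfg))
  · rintro ⟨H, hHG, hH⟩
    obtain ⟨f, hf, hr, hfH⟩ := exists_parent hs hH
    exact ⟨⟨f, (hmem f).2 ⟨fun i => hHG (hf i), hr⟩⟩, Subtype.ext hfH⟩

end

end KirchhoffAux

/-- **Kirchhoff's theorem (eigenvalue form).**  For a connected finite simple graph `G`
on `N ≥ 2` vertices, `0` is a simple eigenvalue of the Laplacian matrix, and the number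
of spanning trees equals `1/N` times the product of the remaining `N − 1` (nonzero)
eigenvalues, taken with multiplicity. -/
theorem kirchhoff_eigenvalue_form {V : Type*} [Fintype V] [DecidableEq V]
    (G : SimpleGraph V) [DecidableRel G.Adj] {N : ℕ} (hN : Fintype.card V = N)
    (h2 : 2 ≤ N) (hconn : G.Connected) (hL : (G.lapMatrix ℝ).IsHermitian) :
    ∃ i₀ : V, hL.eigenvalues i₀ = 0 ∧ (∀ i : V, i ≠ i₀ → hL.eigenvalues i ≠ 0) ∧
      (spanningTreeCount G : ℝ) =
        (1 / (N : ℝ)) * ∏ i ∈ Finset.univ.erase i₀, hL.eigenvalues i := by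
  classical
  have := hconn.nonempty
  have hN0 : (N : ℝ) ≠ 0 := by
    have : N ≠ 0 := by omega
    exact_mod_cast this
  have hpos : spanningTreeCount G ≠ 0 := by
    obtain ⟨T, hT, hT2⟩ := hconn.exists_isTree_le
    have : Nonempty {H : SimpleGraph V // H ≤ G ∧ H.IsTree} := ⟨⟨T, hT, hT2⟩⟩
    exact Nat.card_pos.ne'
  have hdet := G.det_lapMatrix_eq_zero
  rw [hL.det_eq_prod_eigenvalues] at hdet
  obtain ⟨i₀, -, hi₀⟩ := Finset.prod_eq_zero_iff.1 hdet
  have hi₀ : hL.eigenvalues i₀ = 0 := by simpa using hi₀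
  have hminors := Matrix.charpoly_coeff_eq_sum_minors (G.lapMatrix ℝ) (N - 1) (by omega)
  have hsum : ∑ s ∈ (Finset.univ : Finset V).powersetCard (N - 1),
      ((G.lapMatrix ℝ).submatrix (Subtype.val : s → V) (Subtype.val : s → V)).det
      = N * (spanningTreeCount G : ℝ) := by
    rw [Finset.sum_congr rfl (g := fun _ => (spanningTreeCount G : ℝ))]
    · rw [Finset.sum_const, Finset.card_powersetCard, Finset.card_univ, hN, nsmul_eq_mul]
      congr 2
      have := Nat.choose_symm (n := N) (k := 1) (by omega)
      simpa using this
    · intro s hs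
      rw [Finset.mem_powersetCard] at hs
      have hc : sᶜ.card = 1 := by
        rw [Finset.card_compl]; omega
      obtain ⟨r, hr⟩ := Finset.card_eq_one.1 hc
      refine KirchhoffAux.minor_eq (r := r) G fun v => ?_
      have := Finset.ext_iff.1 hr v
      simp only [Finset.mem_compl, Finset.mem_singleton] at this
      rw [ne_eq, ← this, not_not]
  have hprod : ∏ i ∈ Finset.univ.erase i₀, hL.eigenvalues i = N * (spanningTreeCount G : ℝ) := by
    rw [hsum, hL.charpoly_eq, ← Finset.mul_prod_erase _ _ (Finset.mem_univ i₀), hi₀, hN,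
      show N - (N - 1) = 1 by omega] at hminors
    simp only [RCLike.ofReal_real_eq_id, id, Polynomial.C_0, sub_zero] at hminors
    rw [show (1 : ℕ) = 0 + 1 from rfl, Polynomial.coeff_X_mul, Polynomial.coeff_zero_eq_eval_zero, Polynomial.eval_prod] at hminors
    simp only [Polynomial.eval_sub, Polynomial.eval_X, Polynomial.eval_C, zero_sub] at hminors
    rw [Finset.prod_neg, Finset.card_erase_of_mem (Finset.mem_univ _), Finset.card_univ, hN]
      at hminors
    exact mul_left_cancel₀ (pow_ne_zero _ (by norm_num)) hminors
  refine ⟨i₀, hi₀, ?_, ?_⟩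
  · intro i hi h0
    have : ∏ i ∈ Finset.univ.erase i₀, hL.eigenvalues i = 0 :=
      Finset.prod_eq_zero (Finset.mem_erase.2 ⟨hi, Finset.mem_univ i⟩) h0
    rw [hprod] at this
    exact (mul_ne_zero hN0 (by exact_mod_cast hpos)) this
  · rw [hprod]
    field_simp
end

section
/- Kirchhoff's theorem for multigraphs (weighted matrix–tree theorem): Let m encode a loopless multigraph on a finite vertex set W with |W| = n ≥ 2, and define its Laplacian L(m) by L(m)_{ii} = Σ_{v ∈ W} m(i,v) and L(m)_{ij} = −m(i,j) for i ≠ j. Then for every vertex j ∈ W, the spanning-tree count t(m) equals the determinant of the (n−1)×(n−1) matrix obtained from L(m) by deleting the row and column indexed by j. -/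
/-- The number of spanning trees of a loopless multigraph on a finite vertex set `W`,
encoded by a symmetric multiplicity function `m` vanishing on the diagonal:
the sum, over all edge sets `F` of unordered pairs on `W` such that `(W, F)` is a tree,
of the product of multiplicities `m(u,v)` over the edges `{u,v} ∈ F`. -/
noncomputable def multiTreeCount {W : Type*} [Fintype W] (m : W → W → ℕ)
    (hm : ∀ x y, m x y = m y x) : ℕ := by
  classical
  exact ∑ H : SimpleGraph W, if H.IsTree then
    ∏ e : Sym2 W, (if e ∈ H.edgeSet then Sym2.lift ⟨m, hm⟩ e else 1) else 0

namespace MTT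

open Finset

variable {W : Type*} [Fintype W] [DecidableEq W] {j : W}

/-- Extend a parent map by fixing the root. -/
def ext (f : {i : W // i ≠ j} → W) (i : W) : W := if h : i ≠ j then f ⟨i, h⟩ else j

lemma ext_root (f : {i : W // i ≠ j} → W) : ext f j = j := by simp [ext]

lemma ext_sub (f : {i : W // i ≠ j} → W) (i : {i : W // i ≠ j}) : ext f i = f i := by
  simp [ext, i.2]

lemma iter_root (f : {i : W // i ≠ j} → W) (k : ℕ) : (ext f)^[k] j = j :=
  Function.iterate_fixed (ext_root f) k

/-- Every vertex is led to the root. -/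
def Acyc (f : {i : W // i ≠ j} → W) : Prop := ∀ i, ∃ k, (ext f)^[k] i = j

/-- the transition matrix -/
def N (f : {i : W // i ≠ j} → W) : Matrix {i : W // i ≠ j} {i : W // i ≠ j} ℤ :=
  Matrix.of fun i l => if f i = l then 1 else 0

lemma acyc_induct {f : {i : W // i ≠ j} → W} (hf : Acyc f) (P : W → Prop) (hj : P j)
    (hs : ∀ i : {i : W // i ≠ j}, P (f i) → P i) (i : W) : P i := by
  obtain ⟨k, hk⟩ := hf i
  induction k generalizing i with
  | zero => simp at hk; exact hk ▸ hj
  | succ k ih =>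
    by_cases h : i = j
    · exact h ▸ hj
    · apply hs ⟨i, h⟩
      apply ih
      rw [Function.iterate_succ_apply] at hk
      rwa [← ext_sub f ⟨i, h⟩]

/-- no nonempty invariant set avoids the root -/
lemma acyc_invariant {f : {i : W // i ≠ j} → W} (hf : Acyc f) (P : W → Prop) (hj : ¬ P j)
    (hs : ∀ i : {i : W // i ≠ j}, P i → P (f i)) (i : W) : ¬ P i :=
  acyc_induct hf (fun i => ¬ P i) hj (fun i h h' => h (hs i h')) i

lemma N_pow (f : {i : W // i ≠ j} → W) (k : ℕ) (i l : {i : W // i ≠ j}) :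
    (N f ^ k) i l = if (ext f)^[k] i = l then 1 else 0 := by
  induction k generalizing i with
  | zero =>
    rw [pow_zero, Matrix.one_apply, Function.iterate_zero_apply]
    simp only [Subtype.ext_iff]
  | succ k ih =>
    rw [pow_succ', Matrix.mul_apply, Function.iterate_succ_apply, ext_sub]
    simp only [ih]
    simp only [N, Matrix.of_apply]
    by_cases h : f i = j
    · rw [h, iter_root, if_neg (fun h => l.2 h.symm)]
      apply Finset.sum_eq_zero
      intro a _
      rw [if_neg (fun h => a.2 h.symm), zero_mul]
    · rw [Finset.sum_eq_single ⟨f i, h⟩]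
      · simp
      · intro b _ hb
        rw [if_neg (fun h => hb (Subtype.ext h.symm)), zero_mul]
      · simp

lemma det_acyc {f : {i : W // i ≠ j} → W} (hf : Acyc f) : (1 - N f).det = 1 := by
  have hnil : IsNilpotent (N f) := by
    choose k hk using hf
    refine ⟨∑ i, k i, ?_⟩
    ext i l
    rw [N_pow]
    have h1 : k i ≤ ∑ i, k i := Finset.single_le_sum (f := k) (fun _ _ => Nat.zero_le _) (mem_univ _)
    rw [← Nat.sub_add_cancel h1, Function.iterate_add_apply, hk, iter_root,
      if_neg (fun h => l.2 h.symm)]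
    rfl
  have h := Matrix.isNilpotent_charpoly_sub_pow_of_isNilpotent hnil
  have h2 := sub_eq_zero.1 h.eq_zero
  have h3 := Matrix.eval_charpoly (N f) 1
  rw [h2] at h3
  simpa using h3.symm

lemma det_not_acyc {f : {i : W // i ≠ j} → W} (hf : ¬ Acyc f) : (1 - N f).det = 0 := by
  classical
  unfold Acyc at hf
  push Not at hf
  obtain ⟨i, hi⟩ := hf
  apply Matrix.exists_mulVec_eq_zero_iff.1
  refine ⟨fun a => if ∃ k, (ext f)^[k] a = j then 0 else 1, ?_, ?_⟩
  · intro h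
    have := congrFun h ⟨i, hi 0⟩
    simp [hi] at this
  · ext a
    have hiff : (∃ k, (ext f)^[k] (a : W) = j) ↔ ∃ k, (ext f)^[k] (f a) = j := by
      constructor
      · rintro ⟨k, hk⟩
        refine ⟨k, ?_⟩
        rw [← ext_sub f a, ← Function.iterate_succ_apply, Function.iterate_succ_apply', hk, ext_root]
      · rintro ⟨k, hk⟩
        exact ⟨k + 1, by rw [Function.iterate_succ_apply, ext_sub, hk]⟩
    rw [Matrix.sub_mulVec, Matrix.one_mulVec, Pi.sub_apply, Pi.zero_apply, sub_eq_zero]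
    simp only [Matrix.mulVec, dotProduct, N, Matrix.of_apply]
    by_cases h : f a = j
    · rw [if_pos (hiff.2 ⟨0, h⟩)]
      symm
      apply Finset.sum_eq_zero
      intro b _
      rw [if_neg (fun h' => b.2 (h'.symm.trans h)), zero_mul]
    · rw [Finset.sum_eq_single ⟨f a, h⟩]
      · simp only [hiff, if_true, one_mul]
      · intro b _ hb
        rw [if_neg (fun h => hb (Subtype.ext h.symm)), zero_mul]
      · simp

lemma det_expand (m : W → W → ℕ) (hdiag : ∀ i, m i i = 0) :
    ((Matrix.of (fun i k : W => if i = k then (∑ v : W, (m i v : ℤ)) else -(m i k))).submatrix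
        (fun i : {i : W // i ≠ j} => (i : W)) (fun i : {i : W // i ≠ j} => (i : W))).det =
    ∑ f : {i : W // i ≠ j} → W, (∏ i : {i : W // i ≠ j}, (m i (f i) : ℤ)) * (1 - N f).det := by
  have h : ((Matrix.of (fun i k : W => if i = k then (∑ v : W, (m i v : ℤ)) else -(m i k))).submatrix
        (fun i : {i : W // i ≠ j} => (i : W)) (fun i : {i : W // i ≠ j} => (i : W))) =
      fun i : {i : W // i ≠ j} => ∑ v : W, (m i v : ℤ) • (fun l : {i : W // i ≠ j} =>
        (if i = l then (1 : ℤ) else 0) - (if v = l then 1 else 0)) := by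
    ext i l
    simp only [Matrix.submatrix_apply, Matrix.of_apply, Finset.sum_apply, Pi.smul_apply,
      smul_eq_mul, mul_sub, Finset.sum_sub_distrib]
    by_cases h : i = l
    · subst h; simp [hdiag]
    · have h' : (i : W) ≠ l := fun h' => h (Subtype.ext h')
      simp [h, h']
  rw [h]
  have := (Matrix.detRowAlternating (n := {i : W // i ≠ j}) (R := ℤ)).toMultilinearMap.map_sum
    (fun (i : {i : W // i ≠ j}) (v : W) => (m i v : ℤ) • (fun l : {i : W // i ≠ j} =>
        (if i = l then (1 : ℤ) else 0) - (if v = l then 1 else 0)))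
  refine this.trans ?_
  apply Finset.sum_congr rfl
  intro f _
  rw [MultilinearMap.map_smul_univ, smul_eq_mul]
  congr 2

/-- The graph of a parent map. -/
def G (f : {i : W // i ≠ j} → W) : SimpleGraph W :=
  SimpleGraph.fromEdgeSet (Set.range fun i : {i : W // i ≠ j} => s((i : W), f i))

lemma acyc_ne {f : {i : W // i ≠ j} → W} (hf : Acyc f) (i : {i : W // i ≠ j}) : f i ≠ i := by
  intro h
  refine acyc_invariant hf (fun a => a = i) (fun h => i.2 h.symm) ?_ i rfl
  intro b hb
  have : b = i := Subtype.ext hb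
  rw [this, h]

lemma G_edgeSet {f : {i : W // i ≠ j} → W} (hf : Acyc f) :
    (G f).edgeSet = Set.range fun i : {i : W // i ≠ j} => s((i : W), f i) := by
  rw [G, SimpleGraph.edgeSet_fromEdgeSet]
  ext e
  simp only [Set.mem_sdiff, and_iff_left_iff_imp]
  rintro ⟨i, rfl⟩
  simpa using (acyc_ne hf i).symm

lemma G_adj {f : {i : W // i ≠ j} → W} (hf : Acyc f) (i : {i : W // i ≠ j}) :
    (G f).Adj i (f i) := by
  rw [← SimpleGraph.mem_edgeSet, G_edgeSet hf]
  exact ⟨i, rfl⟩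

lemma G_connected {f : {i : W // i ≠ j} → W} (hf : Acyc f) : (G f).Connected := by
  have h : ∀ i, (G f).Reachable i j :=
    acyc_induct hf _ (SimpleGraph.Reachable.refl _) (fun i h => (G_adj hf i).reachable.trans h)
  have : Nonempty W := ⟨j⟩
  exact ⟨fun a b => (h a).trans (h b).symm⟩

lemma G_card_aux {f : {i : W // i ≠ j} → W} (hf : Acyc f) :
    Nat.card (G f).edgeSet = Nat.card {i : W // i ≠ j} ∧
      Nat.card {i : W // i ≠ j} + 1 = Nat.card W := by
  have h0 : Nat.card {i : W // i ≠ j} + 1 = Nat.card W := by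
    have hp : 0 < Fintype.card W := Fintype.card_pos_iff.2 ⟨j⟩
    have := Fintype.card_subtype_compl (fun i : W => i = j)
    rw [Fintype.card_subtype_eq] at this
    simp only [Nat.card_eq_fintype_card]
    change Fintype.card {i : W // ¬ i = j} + 1 = _
    omega
  have h1 := (G_connected hf).card_vert_le_card_edgeSet_add_one
  have h2 : Nat.card (G f).edgeSet ≤ Nat.card {i : W // i ≠ j} := by
    rw [G_edgeSet hf]
    exact Finite.card_range_le _
  omega

lemma G_isTree {f : {i : W // i ≠ j} → W} (hf : Acyc f) : (G f).IsTree := by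
  rw [SimpleGraph.isTree_iff_connected_and_card]
  have := G_card_aux hf
  exact ⟨G_connected hf, by omega⟩

lemma edge_inj {f : {i : W // i ≠ j} → W} (hf : Acyc f) :
    Function.Injective (fun i : {i : W // i ≠ j} => s((i : W), f i)) := by
  have h := (G_card_aux hf).1
  rw [G_edgeSet hf] at h
  have hs := Set.rangeFactorization_surjective (f := fun i : {i : W // i ≠ j} => s((i : W), f i))
  have hb := (Nat.bijective_iff_surjective_and_card _).2 ⟨hs, h.symm⟩
  intro a b hab
  exact hb.1 (Subtype.ext hab)

lemma G_inj {f g : {i : W // i ≠ j} → W} (hf : Acyc f) (hg : Acyc g) (h : G f = G g) :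
    f = g := by
  have he : ∀ i : {i : W // i ≠ j}, ∃ k : {i : W // i ≠ j}, s((k : W), g k) = s((i : W), f i) := by
    intro i
    have := G_adj hf i
    rw [h, ← SimpleGraph.mem_edgeSet, G_edgeSet hg] at this
    exact this
  have key := acyc_invariant hf (fun a => ∃ ha : a ≠ j, f ⟨a, ha⟩ ≠ g ⟨a, ha⟩)
    (by simp) (by
      rintro i ⟨ha, hne⟩
      obtain ⟨k, hk⟩ := he i
      rw [Sym2.eq_iff] at hk
      rcases hk with ⟨h1, h2⟩ | ⟨h1, h2⟩
      · exact absurd (by rw [← h2, Subtype.ext h1]) hne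
      · refine ⟨h1 ▸ k.2, ?_⟩
        have hk' : k = ⟨f i, h1 ▸ k.2⟩ := Subtype.ext h1
        rw [← hk', h2]
        intro h3
        refine acyc_invariant hf (fun a => a = i ∨ a = k) ?_ ?_ i (Or.inl rfl)
        · rintro (h | h)
          · exact i.2 h.symm
          · exact k.2 h.symm
        · rintro b (hb | hb)
          · right; rw [Subtype.ext hb, h1]
          · left; rw [Subtype.ext hb, h3])
  ext i
  by_contra hc
  exact key i ⟨i.2, hc⟩

lemma G_surj {H : SimpleGraph W} (hH : H.IsTree) :
    ∃ f : {i : W // i ≠ j} → W, Acyc f ∧ G f = H := by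
  have hc := hH.1
  have h1 : ∀ i : {i : W // i ≠ j}, ∃ v, H.Adj i v ∧ H.dist v j < H.dist i j := by
    rintro ⟨i, hi⟩
    change ∃ v, H.Adj i v ∧ H.dist v j < H.dist i j
    obtain ⟨p, hp⟩ := hc.exists_walk_length_eq_dist i j
    cases p with
    | nil => exact absurd rfl hi
    | cons h q =>
      refine ⟨_, h, ?_⟩
      have := SimpleGraph.dist_le q
      simp at hp
      omega
  choose f hadj hlt using h1
  have hf : Acyc f := by
    intro i
    induction hn : H.dist i j using Nat.strong_induction_on generalizing i with
    | _ n ih =>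
      by_cases h : i = j
      · exact ⟨0, h⟩
      · obtain ⟨k, hk⟩ := ih _ (hn ▸ hlt ⟨i, h⟩) (f ⟨i, h⟩) rfl
        exact ⟨k + 1, by
          rw [← ext_sub f ⟨i, h⟩] at hk
          rwa [Function.iterate_succ_apply]⟩
  refine ⟨f, hf, ?_⟩
  have hle : G f ≤ H := by
    rw [← SimpleGraph.edgeSet_subset_edgeSet, G_edgeSet hf]
    rintro _ ⟨i, rfl⟩
    exact hadj i
  exact le_antisymm hle
    ((SimpleGraph.isTree_iff_minimal_connected.1 hH).2 (G_connected hf) hle)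

lemma weight_eq (m : W → W → ℕ) (hm : ∀ x y, m x y = m y x)
    {f : {i : W // i ≠ j} → W} (hf : Acyc f) [∀ e, Decidable (e ∈ (G f).edgeSet)] :
    ∏ e : Sym2 W, (if e ∈ (G f).edgeSet then Sym2.lift ⟨m, hm⟩ e else 1) =
      ∏ i : {i : W // i ≠ j}, m i (f i) := by
  rw [← Finset.prod_filter]
  have : Finset.univ.filter (fun e => e ∈ (G f).edgeSet) =
      Finset.univ.image (fun i : {i : W // i ≠ j} => s((i : W), f i)) := by
    ext e
    simp [G_edgeSet hf]
  rw [this, Finset.prod_image (fun a _ b _ h => edge_inj hf h)]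
  rfl

lemma count_eq (m : W → W → ℕ) (hm : ∀ x y, m x y = m y x) (j : W)
    [DecidablePred (Acyc (j := j))] :
    multiTreeCount m hm = ∑ f : {i : W // i ≠ j} → W, if Acyc f then ∏ i : {i : W // i ≠ j}, m i (f i) else 0 := by
  classical
  unfold multiTreeCount
  rw [← Finset.sum_filter, ← Finset.sum_filter]
  symm
  refine Finset.sum_bij (fun f _ => G f) ?_ ?_ ?_ ?_
  · intro f hf
    simp only [mem_filter, mem_univ, true_and] at hf ⊢
    exact G_isTree hf
  · intro f hf g hg h
    simp only [mem_filter, mem_univ, true_and] at hf hg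
    exact G_inj hf hg h
  · intro H hH
    simp only [mem_filter, mem_univ, true_and] at hH
    obtain ⟨f, hf, h⟩ := G_surj (j := j) hH
    exact ⟨f, by simpa using hf, h⟩
  · intro f hf
    simp only [mem_filter, mem_univ, true_and] at hf
    exact (weight_eq m hm hf).symm

end MTT

/-- **Kirchhoff's theorem for multigraphs (weighted matrix–tree theorem).**
Let `m` encode a loopless multigraph on a finite vertex set `W` with `|W| = n ≥ 2`, with
Laplacian `L(m)` given by `L(m)_{ii} = Σ_v m(i,v)` and `L(m)_{ij} = −m(i,j)` for `i ≠ j`.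
Then for every vertex `j`, the spanning-tree count `t(m)` equals the determinant of the
`(n−1)×(n−1)` matrix obtained from `L(m)` by deleting the row and column indexed by `j`. -/
theorem multigraph_matrix_tree {W : Type*} [Fintype W] [DecidableEq W]
    (m : W → W → ℕ) (hm : ∀ x y, m x y = m y x) (hdiag : ∀ i, m i i = 0)
    (hcard : 2 ≤ Fintype.card W) (j : W) :
    (multiTreeCount m hm : ℤ) =
      ((Matrix.of (fun i k : W => if i = k then (∑ v : W, (m i v : ℤ)) else -(m i k))).submatrix
        (fun i : {i : W // i ≠ j} => (i : W)) (fun i : {i : W // i ≠ j} => (i : W))).det := by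
  classical
  rw [MTT.det_expand m hdiag, MTT.count_eq m hm j]
  push_cast
  apply Finset.sum_congr rfl
  intro f _
  by_cases hf : MTT.Acyc f
  · rw [if_pos hf, MTT.det_acyc hf, mul_one]
  · rw [if_neg hf, MTT.det_not_acyc hf, mul_zero]
end

section
/- Deletion–contraction recurrence for multigraphs: Let m encode a loopless multigraph on a finite vertex set W with |W| ≥ 3, and let g ≠ h be vertices with μ := m(g,h) ≥ 1. Let m − (g,h) be the multiplicity function equal to m except that the multiplicity of the pair {g,h} is set to 0, and let m/(g,h) be the contraction of m along {g,h}: the multigraph on W ∖ {h} whose multiplicity function agrees with m on pairs not involving g, has multiplicity m(u,g) + m(u,h) between u and g for every u ∈ W ∖ {g,h}, and has no self-loops. Then t(m) = μ · t(m/(g,h)) + t(m − (g,h)). -/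
/-- `m − (g,h)`: the multiplicity function equal to `m` except that the multiplicity of
the pair `{g, h}` is set to `0`. -/
def deleteEdge {W : Type*} [DecidableEq W] (m : W → W → ℕ) (g h : W) : W → W → ℕ :=
  fun u v => if (u = g ∧ v = h) ∨ (u = h ∧ v = g) then 0 else m u v

theorem deleteEdge_symm {W : Type*} [DecidableEq W] {m : W → W → ℕ}
    (hm : ∀ x y, m x y = m y x) (g h : W) :
    ∀ x y, deleteEdge m g h x y = deleteEdge m g h y x := by
  intro x y
  unfold deleteEdge
  split_ifs with h1 h2 <;> first | rfl | tauto | exact hm x y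

/-- `m / (g,h)`: the contraction of `m` along `{g, h}`, a multigraph on `W ∖ {h}` whose
multiplicity function agrees with `m` on pairs not involving `g`, has multiplicity
`m(u,g) + m(u,h)` between `u` and `g` for every `u ∉ {g, h}`, and has no self-loops. -/
def contractEdge {W : Type*} [DecidableEq W] (m : W → W → ℕ) (g h : W) :
    {w : W // w ≠ h} → {w : W // w ≠ h} → ℕ :=
  fun u v =>
    if u = v then 0
    else if (u : W) = g then m (v : W) g + m (v : W) h
    else if (v : W) = g then m (u : W) g + m (u : W) h
    else m (u : W) (v : W)

theorem contractEdge_symm {W : Type*} [DecidableEq W] {m : W → W → ℕ}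
    (hm : ∀ x y, m x y = m y x) (g h : W) :
    ∀ u v, contractEdge m g h u v = contractEdge m g h v u := by
  intro u v
  unfold contractEdge
  by_cases huv : u = v
  · simp [huv]
  have hvu : ¬v = u := fun e => huv e.symm
  rw [if_neg huv, if_neg hvu]
  by_cases hu : (u : W) = g <;> by_cases hv : (v : W) = g
  · exact absurd (Subtype.ext (hu.trans hv.symm)) huv
  · simp [hu, hv]
  · simp [hu, hv]
  · simp [hu, hv, hm (u : W) (v : W)]

/-- The edges of a graph on a finite vertex set, as a finset. -/
noncomputable def eF {V : Type*} [Finite V] (H : SimpleGraph V) : Finset (Sym2 V) :=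
  (Set.toFinite H.edgeSet).toFinset

/-- The finset of all trees on `V`. -/
noncomputable def treeF (V : Type*) [Finite V] : Finset (SimpleGraph V) :=
  (Set.toFinite {H : SimpleGraph V | H.IsTree}).toFinset

theorem mem_eF {V : Type*} [Finite V] {H : SimpleGraph V} {e : Sym2 V} :
    e ∈ eF H ↔ e ∈ H.edgeSet := by simp [eF]

theorem mem_treeF {V : Type*} [Finite V] {H : SimpleGraph V} :
    H ∈ treeF V ↔ H.IsTree := by simp [treeF]

theorem eF_card {V : Type*} [Finite V] (H : SimpleGraph V) :
    (eF H).card = Nat.card H.edgeSet := by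
  rw [eF, ← Set.ncard_eq_toFinset_card, Nat.card_coe_set_eq]

theorem isTree_iff_eF {V : Type*} [Finite V] (H : SimpleGraph V) :
    H.IsTree ↔ H.Connected ∧ (eF H).card + 1 ≤ Nat.card V := by
  rw [SimpleGraph.isTree_iff_connected_and_card, eF_card]
  constructor
  · rintro ⟨a, b⟩; exact ⟨a, b.le⟩
  · rintro ⟨a, b⟩; exact ⟨a, le_antisymm b a.card_vert_le_card_edgeSet_add_one⟩

theorem isTree_eF_card {V : Type*} [Finite V] {H : SimpleGraph V} (hH : H.IsTree) :
    (eF H).card + 1 = Nat.card V := by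
  rw [eF_card]; exact (SimpleGraph.isTree_iff_connected_and_card.1 hH).2

theorem multiTreeCount_eq {W : Type*} [Fintype W] (m : W → W → ℕ)
    (hm : ∀ x y, m x y = m y x) :
    multiTreeCount m hm = ∑ H ∈ treeF W, ∏ e ∈ eF H, Sym2.lift ⟨m, hm⟩ e := by
  classical
  unfold multiTreeCount
  rw [← Finset.sum_filter]
  refine Finset.sum_congr ?_ fun H _ => ?_
  · ext H; simp [mem_treeF]
  · rw [← Finset.prod_filter]
    refine Finset.prod_congr ?_ fun _ _ => rfl
    ext e; simp [mem_eF]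

/-- The quotient map identifying `h` with `g`. -/
def proj {W : Type*} [DecidableEq W] (g h : W) (hgh : g ≠ h) (x : W) : {w : W // w ≠ h} :=
  if hx : x = h then ⟨g, hgh⟩ else ⟨x, hx⟩

theorem proj_eq {W : Type*} [DecidableEq W] {g h : W} (hgh : g ≠ h) (x : W)
    (u : {w : W // w ≠ h}) :
    proj g h hgh x = u ↔ x = u.1 ∨ (x = h ∧ u.1 = g) := by
  obtain ⟨u, hu⟩ := u
  unfold proj
  split_ifs with hx
  · subst hx; simp [Ne.symm hu, eq_comm]
  · simp [hx]

theorem proj_val {W : Type*} [DecidableEq W] {g h : W} (hgh : g ≠ h)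
    (u : {w : W // w ≠ h}) : proj g h hgh u.1 = u := (proj_eq hgh _ _).2 (Or.inl rfl)

/-- Contraction of a simple graph. -/
def contr {W : Type*} [DecidableEq W] (g h : W) (hgh : g ≠ h) (H : SimpleGraph W) :
    SimpleGraph {w : W // w ≠ h} :=
  SimpleGraph.fromEdgeSet (Sym2.map (proj g h hgh) '' H.edgeSet)

theorem proj_diag {W : Type*} [DecidableEq W] {g h : W} (hgh : g ≠ h) :
    (Sym2.map (proj g h hgh) s(g, h)).IsDiag := by
  have h1 : proj g h hgh g = ⟨g, hgh⟩ := by simp [proj_eq]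
  have h2 : proj g h hgh h = ⟨g, hgh⟩ := by simp [proj_eq]
  simp [h1, h2]

theorem card_sub {W : Type*} [Finite W] (h : W) :
    Nat.card {w : W // w ≠ h} + 1 = Nat.card W := by
  classical
  have := Fintype.ofFinite W
  have : 0 < Fintype.card W := Fintype.card_pos_iff.2 ⟨h⟩
  simp [Fintype.card_subtype_compl]
  omega

theorem contr_isTree {W : Type*} [Finite W] [DecidableEq W] {g h : W} (hgh : g ≠ h)
    {H : SimpleGraph W} (hH : H.IsTree) (hadj : s(g, h) ∈ H.edgeSet) :
    (contr g h hgh H).IsTree := by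
  have key : ∀ a b, H.Reachable a b →
      (contr g h hgh H).Reachable (proj g h hgh a) (proj g h hgh b) := by
    rintro a b ⟨p⟩
    induction p with
    | nil => rfl
    | @cons a b c hab p ih =>
      refine SimpleGraph.Reachable.trans ?_ ih
      by_cases he : proj g h hgh a = proj g h hgh b
      · rw [he]
      · refine SimpleGraph.Adj.reachable ?_
        rw [contr, SimpleGraph.fromEdgeSet_adj]
        exact ⟨⟨s(a, b), hab, rfl⟩, he⟩
  rw [isTree_iff_eF]
  constructor
  · have : Nonempty {w : W // w ≠ h} := ⟨⟨g, hgh⟩⟩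
    refine SimpleGraph.Connected.mk fun u v => ?_
    have := key u.1 v.1 (hH.connected.preconnected _ _)
    rwa [proj_val, proj_val] at this
  · have h1 : eF (contr g h hgh H) ⊆ ((eF H).erase s(g, h)).image (Sym2.map (proj g h hgh)) := by
      intro e he
      rw [mem_eF, contr, SimpleGraph.edgeSet_fromEdgeSet] at he
      obtain ⟨⟨e', he', rfl⟩, hd⟩ := he
      refine Finset.mem_image_of_mem _ (Finset.mem_erase.2 ⟨?_, mem_eF.2 he'⟩)
      rintro rfl
      exact hd (proj_diag hgh)
    have h2 := (Finset.card_le_card h1).trans Finset.card_image_le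
    rw [Finset.card_erase_of_mem (mem_eF.2 hadj)] at h2
    have h3 := isTree_eF_card hH
    have h4 := card_sub h
    have h5 : 0 < (eF H).card := Finset.card_pos.2 ⟨_, mem_eF.2 hadj⟩
    omega

theorem lift_isTree {W : Type*} [Finite W] [DecidableEq W] {g h : W} (hgh : g ≠ h)
    {K : SimpleGraph {w : W // w ≠ h}} (hK : K.IsTree) (F : Finset (Sym2 W))
    (hF : ∀ e ∈ K.edgeSet, ∃ e' ∈ F, Sym2.map (proj g h hgh) e' = e)
    (hc : F.card ≤ (eF K).card) :
    (SimpleGraph.fromEdgeSet (insert s(g, h) (F : Set (Sym2 W)))).IsTree := by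
  set H := SimpleGraph.fromEdgeSet (insert s(g, h) (F : Set (Sym2 W))) with hHdef
  have hgh' : H.Adj g h := by
    rw [hHdef, SimpleGraph.fromEdgeSet_adj]; exact ⟨Set.mem_insert _ _, hgh⟩
  have hpr : ∀ a, H.Reachable a (proj g h hgh a).1 := by
    intro a
    by_cases ha : a = h
    · subst ha
      have : proj g a hgh a = ⟨g, hgh⟩ := by simp [proj_eq]
      rw [this]; exact hgh'.reachable.symm
    · have : proj g h hgh a = ⟨a, ha⟩ := by simp [proj_eq]
      rw [this]
  have hF2 : ∀ a b, s(a, b) ∈ F → H.Reachable a b := by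
    intro a b hab
    by_cases he : a = b
    · rw [he]
    · refine SimpleGraph.Adj.reachable ?_
      rw [hHdef, SimpleGraph.fromEdgeSet_adj]
      exact ⟨Set.mem_insert_of_mem _ hab, he⟩
  have key : ∀ u v, K.Reachable u v → H.Reachable u.1 v.1 := by
    rintro u v ⟨p⟩
    induction p with
    | nil => rfl
    | @cons a b c hab p ih =>
      refine SimpleGraph.Reachable.trans ?_ ih
      obtain ⟨e', he', h2⟩ := hF s(a, b) hab
      induction e' using Sym2.ind with
      | _ x y =>
        have hxy := hF2 x y he'
        have h3 := ((hpr x).symm.trans hxy).trans (hpr y)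
        rw [Sym2.map_mk, Sym2.eq_iff] at h2
        rcases h2 with ⟨rfl, rfl⟩ | ⟨rfl, rfl⟩
        · exact h3
        · exact h3.symm
  rw [isTree_iff_eF]
  constructor
  · have : Nonempty W := ⟨g⟩
    refine SimpleGraph.Connected.mk fun u v => ?_
    exact ((hpr u).trans (key _ _ (hK.connected.preconnected _ _))).trans (hpr v).symm
  · have h1 : eF H ⊆ insert s(g, h) F := by
      intro e he
      rw [mem_eF, hHdef, SimpleGraph.edgeSet_fromEdgeSet] at he
      simpa using he.1
    have h2 := (Finset.card_le_card h1).trans (Finset.card_insert_le _ _)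
    have h3 := isTree_eF_card hK
    have h4 := card_sub h
    omega

theorem fiber_sum {W : Type*} [Fintype W] [DecidableEq W]
    (m : W → W → ℕ) (hm : ∀ x y, m x y = m y x) (g h : W) (hgh : g ≠ h)
    (e : Sym2 {w : W // w ≠ h}) (he : ¬ e.IsDiag) :
    Sym2.lift ⟨contractEdge m g h, contractEdge_symm hm g h⟩ e =
      ∑ e' ∈ Finset.univ.filter (fun e' => Sym2.map (proj g h hgh) e' = e),
        Sym2.lift ⟨m, hm⟩ e' := by
  have special : ∀ v : {w : W // w ≠ h}, v.1 ≠ g →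
      ∑ e' ∈ Finset.univ.filter (fun e' => Sym2.map (proj g h hgh) e' = s(⟨g, hgh⟩, v)),
        Sym2.lift ⟨m, hm⟩ e' = m v.1 g + m v.1 h := by
    intro v hv
    have hv2 := v.2
    have : Finset.univ.filter (fun e' => Sym2.map (proj g h hgh) e' = s(⟨g, hgh⟩, v)) =
        {s(v.1, g), s(v.1, h)} := by
      ext e'
      induction e' using Sym2.ind with
      | _ x y =>
        simp only [Finset.mem_filter, Finset.mem_univ, true_and, Sym2.map_mk, Sym2.eq_iff,
          proj_eq, Finset.mem_insert, Finset.mem_singleton]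
        simp only [hv, and_false, or_false, and_true]
        tauto
    rw [this, Finset.sum_pair]
    · simp
    · simp [Sym2.eq_iff, hgh, hv2]
  induction e using Sym2.ind with
  | _ u v =>
    have huv : u ≠ v := by simpa using he
    by_cases hu : u.1 = g
    · have hu' : u = ⟨g, hgh⟩ := Subtype.ext hu
      have hv : v.1 ≠ g := fun hv => huv (Subtype.ext (hu.trans hv.symm))
      have := special v hv
      rw [hu'] at huv ⊢
      rw [this]
      simp [contractEdge, huv]
    · by_cases hv : v.1 = g
      · have hv' : v = ⟨g, hgh⟩ := Subtype.ext hv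
        have := special u hu
        rw [hv'] at huv ⊢
        rw [Sym2.eq_swap, this]
        simp [contractEdge, huv.symm, huv]
      · have : Finset.univ.filter (fun e' => Sym2.map (proj g h hgh) e' = s(u, v)) =
            {s(u.1, v.1)} := by
          ext e'
          induction e' using Sym2.ind with
          | _ x y =>
            simp only [Finset.mem_filter, Finset.mem_univ, true_and, Sym2.map_mk, Sym2.eq_iff,
              proj_eq, Finset.mem_singleton]
            simp only [hu, hv, and_false, or_false]
        rw [this, Finset.sum_singleton]
        simp [contractEdge, huv, hu, hv]

theorem contract_part {W : Type*} [Fintype W] [DecidableEq W]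
    (m : W → W → ℕ) (hm : ∀ x y, m x y = m y x) (g h : W) (hgh : g ≠ h)
    (K : SimpleGraph {w : W // w ≠ h}) (hK : K.IsTree) (T : Finset (SimpleGraph W))
    (hT : ∀ H, H ∈ T ↔ (H.IsTree ∧ s(g, h) ∈ H.edgeSet) ∧ contr g h hgh H = K) :
    m g h * ∏ e ∈ eF K, Sym2.lift ⟨contractEdge m g h, contractEdge_symm hm g h⟩ e =
      ∑ H ∈ T, ∏ e ∈ eF H, Sym2.lift ⟨m, hm⟩ e := by
  have hnd : ∀ e ∈ eF K, ¬ e.IsDiag := fun e he =>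
    SimpleGraph.not_isDiag_of_mem_edgeSet _ (mem_eF.1 he)
  rw [Finset.prod_congr rfl fun e he => fiber_sum m hm g h hgh e (hnd e he), Finset.prod_sum,
    Finset.mul_sum]
  set F : (∀ e ∈ eF K, Sym2 W) → Finset (Sym2 W) :=
    fun p => (eF K).attach.image fun e => p e.1 e.2 with hFdef
  have memF : ∀ p e', e' ∈ F p ↔ ∃ e, ∃ he : e ∈ eF K, p e he = e' := by
    intro p e'; simp [hFdef]
  have hp : ∀ p ∈ (eF K).pi (fun e => Finset.univ.filter
      (fun e' => Sym2.map (proj g h hgh) e' = e)), ∀ e he,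
      Sym2.map (proj g h hgh) (p e he) = e := by
    intro p hp e he
    have := Finset.mem_pi.1 hp e he
    simpa using this
  have notdiag : ∀ p : (∀ e ∈ eF K, Sym2 W),
      (∀ e he, Sym2.map (proj g h hgh) (p e he) = e) → ∀ e he, ¬ (p e he).IsDiag := by
    intro p hp e he hd
    apply hnd e he
    rw [← hp e he]
    exact hd.map
  have notgh : ∀ p : (∀ e ∈ eF K, Sym2 W),
      (∀ e he, Sym2.map (proj g h hgh) (p e he) = e) → ∀ e he, p e he ≠ s(g, h) := by
    intro p hp e he hd
    apply hnd e he
    rw [← hp e he, hd]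
    exact proj_diag hgh
  have hE : ∀ p : (∀ e ∈ eF K, Sym2 W),
      (∀ e he, Sym2.map (proj g h hgh) (p e he) = e) →
      eF (SimpleGraph.fromEdgeSet (insert s(g, h) (F p : Set (Sym2 W)))) =
        insert s(g, h) (F p) := by
    intro p hp
    ext e'
    rw [mem_eF, SimpleGraph.edgeSet_fromEdgeSet]
    simp only [Set.mem_diff, Set.mem_insert_iff, Finset.mem_coe, Finset.mem_insert,
      Sym2.mem_diagSet]
    refine ⟨fun hh => hh.1, fun hh => ⟨hh, ?_⟩⟩
    rcases hh with rfl | hh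
    · simpa using hgh
    · obtain ⟨e, he, rfl⟩ := (memF _ _).1 hh
      exact notdiag p hp e he
  have htree : ∀ p : (∀ e ∈ eF K, Sym2 W),
      (∀ e he, Sym2.map (proj g h hgh) (p e he) = e) →
      (SimpleGraph.fromEdgeSet (insert s(g, h) (F p : Set (Sym2 W)))).IsTree := by
    intro p hp
    refine lift_isTree hgh hK (F p) (fun e he => ?_) ?_
    · exact ⟨p e (mem_eF.2 he), (memF _ _).2 ⟨e, mem_eF.2 he, rfl⟩, hp _ _⟩
    · exact Finset.card_image_le.trans (by simp)
  refine Finset.sum_bij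
    (fun p _ => SimpleGraph.fromEdgeSet (insert s(g, h) (F p : Set (Sym2 W)))) ?_ ?_ ?_ ?_
  · intro p hp'
    have hp := hp p hp'
    rw [hT]
    refine ⟨⟨htree p hp, ?_⟩, ?_⟩
    · rw [← mem_eF, hE p hp]; exact Finset.mem_insert_self _ _
    · apply SimpleGraph.edgeSet_injective
      rw [contr, SimpleGraph.edgeSet_fromEdgeSet]
      ext e
      simp only [Set.mem_diff, Set.mem_image, ← mem_eF, hE p hp, Sym2.mem_diagSet]
      constructor
      · rintro ⟨⟨e', he', rfl⟩, hd⟩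
        rcases Finset.mem_insert.1 he' with rfl | he'
        · exact absurd (proj_diag hgh) hd
        · obtain ⟨e, he, rfl⟩ := (memF _ _).1 he'
          rwa [hp e he]
      · intro he
        exact ⟨⟨p e he, Finset.mem_insert_of_mem ((memF _ _).2 ⟨e, he, rfl⟩), hp e he⟩, hnd e he⟩
  · intro p hp' q hq' heq
    have hp1 := hp p hp'
    have hq1 := hp q hq'
    have h1 := congrArg eF heq
    simp only [hE p hp1, hE q hq1] at h1
    funext e he
    have h2 : p e he ∈ insert s(g, h) (F q) := by
      rw [← h1]; exact Finset.mem_insert_of_mem ((memF _ _).2 ⟨e, he, rfl⟩)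
    rcases Finset.mem_insert.1 h2 with h2 | h2
    · exact absurd h2 (notgh p hp1 e he)
    · obtain ⟨e2, he2, h3⟩ := (memF _ _).1 h2
      have h4 := hq1 e2 he2
      rw [h3, hp1 e he] at h4
      subst h4
      exact h3.symm
  · intro H hH
    obtain ⟨⟨hHt, hHe⟩, hHK⟩ := (hT H).1 hH
    have hex : ∀ e, ∀ he : e ∈ eF K, ∃ e', e' ∈ H.edgeSet ∧ Sym2.map (proj g h hgh) e' = e := by
      intro e he
      rw [mem_eF, ← hHK, contr, SimpleGraph.edgeSet_fromEdgeSet] at he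
      exact he.1
    choose p hpH hpe using hex
    refine ⟨p, ?_, ?_⟩
    · rw [Finset.mem_pi]; intro e he; simpa using hpe e he
    · apply SimpleGraph.edgeSet_injective
      have hsub : eF (SimpleGraph.fromEdgeSet (insert s(g, h) (F p : Set (Sym2 W)))) ⊆ eF H := by
        rw [hE p hpe]
        intro e' he'
        rcases Finset.mem_insert.1 he' with rfl | he'
        · exact mem_eF.2 hHe
        · obtain ⟨e, he, rfl⟩ := (memF _ _).1 he'
          exact mem_eF.2 (hpH e he)
      have heq := Finset.eq_of_subset_of_card_le hsub (by
        have h1 := isTree_eF_card (htree p hpe)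
        have h2 := isTree_eF_card hHt
        omega)
      ext e
      rw [← mem_eF, heq, mem_eF]
  · intro p hp'
    have hp := hp p hp'
    rw [hE p hp, Finset.prod_insert, Finset.prod_image]
    · simp
    · rintro ⟨a, ha⟩ _ ⟨b, hb⟩ _ hab
      have := congrArg (Sym2.map (proj g h hgh)) hab
      simp only [hp] at this
      exact Subtype.ext this
    · intro hmem
      obtain ⟨e, he, h2⟩ := (memF _ _).1 hmem
      exact notgh p hp e he h2

/-- **Deletion–contraction recurrence for multigraphs.**  For a loopless multigraph `m`
on at least `3` vertices and vertices `g ≠ h` with `μ := m(g,h) ≥ 1`, one has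
`t(m) = μ · t(m/(g,h)) + t(m − (g,h))`. -/
theorem deletion_contraction_multigraph {W : Type*} [Fintype W] [DecidableEq W]
    (m : W → W → ℕ) (hm : ∀ x y, m x y = m y x) (hdiag : ∀ i, m i i = 0)
    (hcard : 3 ≤ Fintype.card W) (g h : W) (hgh : g ≠ h) (hμ : 1 ≤ m g h) :
    multiTreeCount m hm =
      m g h * multiTreeCount (contractEdge m g h) (contractEdge_symm hm g h) +
        multiTreeCount (deleteEdge m g h) (deleteEdge_symm hm g h) := by
  classical
  rw [multiTreeCount_eq, multiTreeCount_eq, multiTreeCount_eq,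
    ← Finset.sum_filter_add_sum_filter_not (treeF W) (fun H => s(g, h) ∈ H.edgeSet)]
  congr 1
  · rw [Finset.mul_sum, ← Finset.sum_fiberwise_of_maps_to
      (t := treeF {w : W // w ≠ h}) (g := contr g h hgh)]
    · refine Finset.sum_congr rfl fun K hK => ?_
      refine (contract_part m hm g h hgh K (mem_treeF.1 hK) _ fun H => ?_).symm
      simp [mem_treeF]
    · intro H hH
      rw [Finset.mem_filter, mem_treeF] at hH
      exact mem_treeF.2 (contr_isTree hgh hH.1 hH.2)
  · rw [Finset.sum_filter]
    refine Finset.sum_congr rfl fun H _ => ?_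
    by_cases hH : s(g, h) ∈ H.edgeSet
    · rw [if_neg (not_not.2 hH)]
      refine (Finset.prod_eq_zero (mem_eF.2 hH) ?_).symm
      simp [deleteEdge]
    · rw [if_pos hH]
      refine Finset.prod_congr rfl fun e he => ?_
      have hne : e ≠ s(g, h) := fun h1 => hH (h1 ▸ mem_eF.1 he)
      induction e using Sym2.ind with
      | _ x y =>
        rw [Ne, Sym2.eq_iff] at hne
        simp [deleteEdge, hne]
end
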